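/- arXiv:2401.02688 — 3 statements merged into one kernel-verified Lean document; each statement's English description precedes it below -/
import Mathlib

section
/- Let Ω ⊂ ℝ² be open and let Γ ⊂ Ω be a simple union of C¹ curve segments. Let δ > 0, let (H_n)_{n≥1} be positive real numbers with H_n → 0, and for each n let S_n ⊆ Γ be a Borel set with ℋ¹(S_n) ≤ δ. Then liminf_{n→∞} (1/(2H_n)) · ℋ²({x ∈ Ω : dist(x, Γ \ S_n) ≤ H_n}) ≥ ℋ¹(Γ) − δ. -/
open MeasureTheory
open scoped ENNReal

noncomputable def IsSimpleCurveUnion (Γ : Set (EuclideanSpace ℝ (Fin 2))) : Prop :=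
  ∃ (K : ℕ) (γ : Fin K → ℝ → EuclideanSpace ℝ (Fin 2)) (b : Fin K → ℝ),
    (∀ i, 0 < b i) ∧
    (∀ i, ContDiff ℝ 1 (γ i)) ∧
    (∀ i t, ‖deriv (γ i) t‖ = 1) ∧
    (∀ i, Set.InjOn (γ i) (Set.Icc 0 (b i))) ∧
    (∀ i j, i ≠ j →
      Disjoint (γ i '' Set.Icc 0 (b i)) (γ j '' Set.Icc 0 (b j))) ∧
    Γ = ⋃ i, γ i '' Set.Icc 0 (b i)

local notation "E2" => EuclideanSpace ℝ (Fin 2)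

theorem aux_vol_le (A : Set E2) (hA : MeasurableSet A) : volume A ≤ μH[2] A := by
  have h1 : LipschitzWith 1 (@WithLp.ofLp 2 (Fin 2 → ℝ)) := by
    simpa using PiLp.lipschitzWith_ofLp 2 (fun _ : Fin 2 => ℝ)
  have h2 := h1.hausdorffMeasure_image_le (d := 2) (by norm_num) A
  have h3 : (μH[2] : Measure (Fin 2 → ℝ)) = volume := by
    have := hausdorffMeasure_pi_real (ι := Fin 2)
    simpa using this
  rw [h3] at h2
  have h4 : (@WithLp.ofLp 2 (Fin 2 → ℝ)) '' A = (WithLp.toLp 2) ⁻¹' A := by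
    ext x
    constructor
    · rintro ⟨y, hy, rfl⟩; exact hy
    · intro hx; exact ⟨WithLp.toLp 2 x, hx, rfl⟩
  rw [h4, (PiLp.volume_preserving_toLp (Fin 2)).measure_preimage hA.nullMeasurableSet] at h2
  simpa using h2

theorem aux_strip (e : E2) (he : ‖e‖ = 1) (B : Set E2) (h : ℝ) (hh : 0 < h) :
    ENNReal.ofReal (2 * h) * volume ((fun p : E2 => inner ℝ e p) '' B) ≤
      volume (Metric.cthickening h B) := by
  obtain ⟨b, hb⟩ := Orthonormal.exists_orthonormalBasis_extension_of_card_eq (𝕜 := ℝ)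
    (E := E2) (ι := Fin 2) (by simp) (v := fun _ => e) (s := {0}) (by
      constructor
      · intro i; simpa using he
      · intro i j hij; exact absurd (Subsingleton.elim i j) hij)
  have hb0 : b 0 = e := hb 0 rfl
  have hmp : MeasurePreserving (fun z : ℝ × ℝ => z.1 • b 0 + z.2 • b 1) volume volume := by
    have := b.measurePreserving_repr_symm.comp ((PiLp.volume_preserving_toLp (Fin 2)).comp
      (volume_preserving_finTwoArrow ℝ).symm)
    convert this using 1
    ext1 z
    simp only [Function.comp_apply]
    apply b.repr.injective
    rw [LinearIsometryEquiv.apply_symm_apply]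
    ext i
    fin_cases i <;> simp [b.repr_self]
  have hC : MeasurableSet (Metric.cthickening h B) := Metric.isClosed_cthickening.measurableSet
  rw [← hmp.measure_preimage hC.nullMeasurableSet, Measure.volume_eq_prod,
    Measure.prod_apply (hmp.measurable hC)]
  refine le_trans ?_ (mul_meas_ge_le_lintegral
    (measurable_measure_prodMk_left (hmp.measurable hC)) (ENNReal.ofReal (2 * h)))
  gcongr
  rintro _ ⟨p, hp, rfl⟩
  have hpe : p = (inner ℝ (b 0) p : ℝ) • b 0 + (inner ℝ (b 1) p : ℝ) • b 1 := by
    conv_lhs => rw [← b.sum_repr' p]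
    simp [Fin.sum_univ_two]
  have : Set.Icc (inner ℝ (b 1) p - h) (inner ℝ (b 1) p + h) ⊆
      Prod.mk (inner ℝ e p : ℝ) ⁻¹' ((fun z : ℝ × ℝ => z.1 • b 0 + z.2 • b 1) ⁻¹'
        Metric.cthickening h B) := by
    intro y hy
    refine Metric.mem_cthickening_of_dist_le _ p _ _ hp ?_
    simp only
    rw [← hb0, dist_eq_norm]
    have : (inner ℝ (b 0) p : ℝ) • b 0 + y • b 1 - p = (y - inner ℝ (b 1) p) • b 1 := by
      nth_rw 2 [hpe]
      module
    rw [this, norm_smul, b.norm_eq_one, mul_one, Real.norm_eq_abs, abs_le]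
    constructor <;> linarith [hy.1, hy.2]
  have h5 := measure_mono (μ := volume) this
  rw [Real.volume_Icc] at h5
  refine le_trans (le_of_eq ?_) h5
  congr 1; ring

theorem aux_proj (K : NNReal) (e : E2) (B : Set E2)
    (hB : ∀ p ∈ B, ∀ q ∈ B, ‖p - q‖ ≤ K * |inner ℝ e (p - q)|) :
    μH[1] B ≤ K * volume ((fun p : E2 => (inner ℝ e p : ℝ)) '' B) := by
  set f : E2 → ℝ := fun p => inner ℝ e p with hf
  have hinj : Set.InjOn f B := by
    intro p hp q hq hpq
    have := hB p hp q hq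
    have h0 : (inner ℝ e (p - q) : ℝ) = 0 := by
      rw [inner_sub_right]; simpa [sub_eq_zero] using hpq
    rw [h0] at this
    simp at this
    exact sub_eq_zero.1 this
  set g := Function.invFunOn f B
  have hg : ∀ p ∈ B, g (f p) = p := fun p hp => hinj.leftInvOn_invFunOn hp
  have hL : LipschitzOnWith K g (f '' B) := by
    refine LipschitzOnWith.of_dist_le_mul ?_
    rintro _ ⟨p, hp, rfl⟩ _ ⟨q, hq, rfl⟩
    rw [hg p hp, hg q hq, dist_eq_norm, Real.dist_eq]
    simpa [hf, inner_sub_right] using hB p hp q hq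
  have := hL.hausdorffMeasure_image_le (d := 1) zero_le_one
  rw [hausdorffMeasure_real] at this
  have hi : g '' (f '' B) = B := by
    rw [Set.image_image]
    ext x
    constructor
    · rintro ⟨p, hp, rfl⟩; simpa only [hg p hp] using hp
    · intro hx; exact ⟨x, hx, hg x hx⟩
  rw [hi] at this
  simpa using this

/-- tube estimate with multiplicative constant `K` -/
def Tube (K : NNReal) (M : Set E2) : Prop :=
  ∀ η : NNReal, 0 < η → ∃ r : ℝ, 0 < r ∧ ∀ h : ℝ, 0 < h → h < r → ∀ B : Set E2,
    MeasurableSet B → B ⊆ M →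
    μH[1] B ≤ K * (ENNReal.ofReal (1 / (2 * h)) * volume (Metric.cthickening h B)) + η

theorem tube_cone (K : NNReal) (e : E2) (he : ‖e‖ = 1) (M : Set E2)
    (hM : ∀ p ∈ M, ∀ q ∈ M, ‖p - q‖ ≤ K * |inner ℝ e (p - q)|) : Tube K M := by
  intro η hη
  refine ⟨1, one_pos, fun h hh _ B _ hBM => ?_⟩
  refine le_trans (aux_proj K e B fun p hp q hq => hM p (hBM hp) q (hBM hq)) ?_
  refine le_trans ?_ le_self_add
  gcongr
  refine le_trans ?_ (mul_le_mul_right (aux_strip e he B h hh) _)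
  rw [← mul_assoc, ← ENNReal.ofReal_mul (by positivity)]
  have : 1 / (2 * h) * (2 * h) = 1 := by field_simp
  rw [this]; simp

theorem tube_union (K : NNReal) (M N : Set E2) (hM : MeasurableSet M) (hN : MeasurableSet N)
    (hMf : μH[1] M < ⊤) (hNf : μH[1] N < ⊤) (tM : Tube K M) (tN : Tube K N) :
    Tube K (M ∪ N) := by
  intro η hη
  have hη4 : (0 : NNReal) < η / 4 := by positivity
  have key : ∀ A : Set E2, MeasurableSet A → μH[1] A < ⊤ →
      ∃ P ⊆ A, IsCompact P ∧ μH[1] (A \ P) ≤ (η / 4 : NNReal) := by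
    intro A hA hAf
    haveI : IsFiniteMeasure ((μH[1] : Measure E2).restrict A) :=
      ⟨by simpa using hAf⟩
    obtain ⟨P, hPA, hP, hlt⟩ := hA.exists_isCompact_sdiff_lt
      (μ := (μH[1] : Measure E2).restrict A) (measure_ne_top _ _)
      (ε := ((η / 4 : NNReal) : ℝ≥0∞)) (by exact_mod_cast hη4.ne')
    refine ⟨P, hPA, hP, ?_⟩
    rw [Measure.restrict_apply (hA.diff hP.measurableSet),
      Set.inter_eq_left.2 Set.diff_subset] at hlt
    exact hlt.le
  obtain ⟨P, hPM, hP, hPm⟩ := key M hM hMf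
  obtain ⟨Q, hQN, hQ, hQm⟩ := key (N \ M) (hN.diff hM)
    (lt_of_le_of_lt (measure_mono Set.diff_subset) hNf)
  have hdisj : Disjoint P Q := by
    rw [Set.disjoint_left]
    intro x hx hx'
    exact (hQN hx').2 (hPM hx)
  obtain ⟨d, hd, hdd⟩ := hdisj.exists_cthickenings hP hQ.isClosed
  obtain ⟨r1, hr1, H1⟩ := tM (η / 4) hη4
  obtain ⟨r2, hr2, H2⟩ := tN (η / 4) hη4
  refine ⟨min d (min r1 r2), by positivity, fun h hh hlt B hB hBs => ?_⟩
  have hl1 : h < d := lt_of_lt_of_le hlt (min_le_left _ _)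
  have hl2 : h < r1 := lt_of_lt_of_le hlt ((min_le_right _ _).trans (min_le_left _ _))
  have hl3 : h < r2 := lt_of_lt_of_le hlt ((min_le_right _ _).trans (min_le_right _ _))
  have a1 := H1 h hh hl2 (B ∩ P) (hB.inter hP.measurableSet) (Set.inter_subset_right.trans hPM)
  have a2 := H2 h hh hl3 (B ∩ Q) (hB.inter hQ.measurableSet)
    (Set.inter_subset_right.trans (hQN.trans Set.diff_subset))
  have hsub : B ⊆ (B ∩ P) ∪ (B ∩ Q) ∪ (M \ P) ∪ ((N \ M) \ Q) := by
    intro x hx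
    have := hBs hx
    simp only [Set.mem_union, Set.mem_inter_iff, Set.mem_diff] at this ⊢
    tauto
  have a3 : μH[1] B ≤ μH[1] (B ∩ P) + μH[1] (B ∩ Q) + (η / 4 : NNReal) + (η / 4 : NNReal) := by
    refine (measure_mono hsub).trans ((measure_union_le _ _).trans ?_)
    gcongr
    refine (measure_union_le _ _).trans ?_
    gcongr
    exact measure_union_le _ _
  have a4 : volume (Metric.cthickening h (B ∩ P)) + volume (Metric.cthickening h (B ∩ Q)) ≤
      volume (Metric.cthickening h B) := by
    rw [← measure_union _ Metric.isClosed_cthickening.measurableSet]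
    · refine measure_mono (Set.union_subset ?_ ?_)
      · exact Metric.cthickening_subset_of_subset _ Set.inter_subset_left
      · exact Metric.cthickening_subset_of_subset _ Set.inter_subset_left
    · refine hdd.mono ?_ ?_
      · exact (Metric.cthickening_mono hl1.le _).trans
          (Metric.cthickening_subset_of_subset _ Set.inter_subset_right)
      · exact (Metric.cthickening_mono hl1.le _).trans
          (Metric.cthickening_subset_of_subset _ Set.inter_subset_right)
  have hsum : ((η / 4 : NNReal) : ℝ≥0∞) + (η / 4 : NNReal) + (η / 4 : NNReal) + (η / 4 : NNReal)
      = η := by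
    norm_cast
    apply NNReal.eq
    push_cast
    ring
  calc μH[1] B ≤ μH[1] (B ∩ P) + μH[1] (B ∩ Q) + (η / 4 : NNReal) + (η / 4 : NNReal) := a3
    _ ≤ (K * (ENNReal.ofReal (1 / (2 * h)) * volume (Metric.cthickening h (B ∩ P))) + (η / 4 : NNReal))
      + (K * (ENNReal.ofReal (1 / (2 * h)) * volume (Metric.cthickening h (B ∩ Q))) + (η / 4 : NNReal))
      + (η / 4 : NNReal) + (η / 4 : NNReal) := by gcongr
    _ = K * (ENNReal.ofReal (1 / (2 * h)) * (volume (Metric.cthickening h (B ∩ P)) +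
          volume (Metric.cthickening h (B ∩ Q)))) + (((η / 4 : NNReal) : ℝ≥0∞)
          + (η / 4 : NNReal) + (η / 4 : NNReal) + (η / 4 : NNReal)) := by ring
    _ ≤ _ := by rw [hsum]; gcongr

/-- `G` is contained in a finite-length Borel set with the tube estimate -/
def QT (K : NNReal) (G : Set E2) : Prop :=
  ∃ M : Set E2, G ⊆ M ∧ MeasurableSet M ∧ μH[1] M < ⊤ ∧ Tube K M

theorem QT.union {K : NNReal} {G G' : Set E2} (h : QT K G) (h' : QT K G') : QT K (G ∪ G') := by
  obtain ⟨M, a, b, c, d⟩ := h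
  obtain ⟨N, a', b', c', d'⟩ := h'
  refine ⟨M ∪ N, Set.union_subset_union a a', b.union b', ?_, tube_union K M N b b' c c' d d'⟩
  exact lt_of_le_of_lt (measure_union_le _ _) (ENNReal.add_lt_top.2 ⟨c, c'⟩)

theorem QT.empty (K : NNReal) : QT K ∅ := by
  refine ⟨∅, le_rfl, MeasurableSet.empty, by simp, ?_⟩
  intro η _
  refine ⟨1, one_pos, fun h _ _ B _ hBs => ?_⟩
  rw [Set.subset_empty_iff.1 hBs]
  simp

theorem QT.curve (K : NNReal) (hK : 1 < K) (γ : ℝ → E2) (hγ : ContDiff ℝ 1 γ)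
    (h1 : ∀ t, ‖deriv γ t‖ = 1) (b : ℝ) : QT K (γ '' Set.Icc 0 b) := by
  have hKr : (1 : ℝ) < K := by exact_mod_cast hK
  have hdiff : Differentiable ℝ γ := hγ.differentiable (by norm_num)
  have hlip : LipschitzWith 1 γ :=
    lipschitzWith_of_nnnorm_deriv_le hdiff (fun x => by
      have := h1 x
      rw [← NNReal.coe_le_coe, coe_nnnorm, this]; simp)
  refine isCompact_Icc.induction_on (p := fun s => QT K (γ '' s)) ?_ ?_ ?_ ?_
  · simpa using QT.empty K
  · rintro s t hst ⟨M, a, r⟩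
    exact ⟨M, (Set.image_mono hst).trans a, r⟩
  · intro s t hs ht
    simp only [Set.image_union]
    exact hs.union ht
  · intro x _
    have hcont : Continuous (deriv γ) := hγ.continuous_deriv (by norm_num)
    have hκ : (0 : ℝ) < 1 - 1 / K := by
      rw [sub_pos, div_lt_one (by linarith)]; exact hKr
    obtain ⟨r, hr, hrb⟩ := Metric.continuous_iff.1 hcont x _ hκ
    have hball : Metric.closedBall x (r / 2) ⊆ Metric.ball x r :=
      Metric.closedBall_subset_ball (by linarith)
    refine ⟨Metric.closedBall x (r / 2),
      mem_nhdsWithin_of_mem_nhds (Metric.closedBall_mem_nhds x (by positivity)),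
      γ '' Metric.closedBall x (r / 2), le_rfl,
      ((isCompact_closedBall x (r / 2)).image hγ.continuous).measurableSet, ?_, ?_⟩
    · refine lt_of_le_of_lt (hlip.hausdorffMeasure_image_le (d := 1) zero_le_one _) ?_
      rw [hausdorffMeasure_real, Real.volume_closedBall]
      simp only [ENNReal.coe_one, ENNReal.one_rpow, one_mul]
      exact ENNReal.ofReal_lt_top
    · refine tube_cone K (deriv γ x) (h1 x) _ ?_
      rintro _ ⟨t, ht, rfl⟩ _ ⟨s, hs, rfl⟩
      set e := deriv γ x
      have hmv : ‖(γ t - t • e) - (γ s - s • e)‖ ≤ (1 - 1 / K) * ‖t - s‖ := by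
        refine Convex.norm_image_sub_le_of_norm_hasDerivWithin_le
          (f := fun u => γ u - u • e) (f' := fun u => deriv γ u - e)
          (s := Metric.closedBall x (r / 2)) ?_ ?_ (convex_closedBall _ _) hs ht
        · intro u _
          have := ((hdiff u).hasDerivAt.sub ((hasDerivAt_id u).smul_const e)).hasDerivWithinAt
            (s := Metric.closedBall x (r / 2))
          rw [one_smul] at this
          exact this
        · intro u hu
          have := hrb u (hball hu)
          rw [dist_eq_norm] at this
          exact this.le
      have hle : ‖γ t - γ s‖ ≤ |t - s| := by
        simpa [dist_eq_norm, Real.dist_eq] using hlip.dist_le_mul t s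
      have hin : (inner ℝ e (γ t - γ s) : ℝ) =
          (t - s) + inner ℝ e ((γ t - t • e) - (γ s - s • e)) := by
        have : γ t - γ s = (t - s) • e + ((γ t - t • e) - (γ s - s • e)) := by module
        rw [this, inner_add_right, inner_smul_right, real_inner_self_eq_norm_sq, h1 x]
        ring
      have hcs := abs_real_inner_le_norm e ((γ t - t • e) - (γ s - s • e))
      rw [h1 x, one_mul] at hcs
      have h3 : |t - s| ≤ |inner ℝ e (γ t - γ s)| +
          |inner ℝ e ((γ t - t • e) - (γ s - s • e))| := by
        have : t - s = inner ℝ e (γ t - γ s) - inner ℝ e ((γ t - t • e) - (γ s - s • e)) := by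
          rw [hin]; ring
        conv_lhs => rw [this]
        exact abs_sub _ _
      rw [Real.norm_eq_abs] at hmv
      have h4 : 1 / (K : ℝ) * |t - s| ≤ |inner ℝ e (γ t - γ s)| := by linarith
      have h5 : |t - s| ≤ K * |inner ℝ e (γ t - γ s)| := by
        rw [one_div, inv_mul_le_iff₀ (by linarith)] at h4
        exact h4
      exact hle.trans h5

theorem QT.simple (K : NNReal) (hK : 1 < K) (Γ : Set E2) (hΓ : IsSimpleCurveUnion Γ) :
    QT K Γ := by
  obtain ⟨k, γ, b, -, h1, h2, -, -, rfl⟩ := hΓ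
  have : ∀ s : Finset (Fin k), QT K (⋃ i ∈ s, γ i '' Set.Icc 0 (b i)) := by
    intro s
    induction s using Finset.induction_on with
    | empty => simpa using QT.empty K
    | insert a s _ ih =>
      rw [Finset.set_biUnion_insert]
      exact (QT.curve K hK (γ a) (h1 a) (h2 a) (b a)).union ih
  simpa using this Finset.univ

theorem simple_compact (Γ : Set E2) (hΓ : IsSimpleCurveUnion Γ) : IsCompact Γ := by
  obtain ⟨k, γ, b, -, h1, h2, -, -, rfl⟩ := hΓ
  exact isCompact_iUnion fun i => isCompact_Icc.image (h1 i).continuous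

theorem stmt0 (Ω : Set (EuclideanSpace ℝ (Fin 2))) (hΩ : IsOpen Ω)
    (Γ : Set (EuclideanSpace ℝ (Fin 2))) (hΓ : IsSimpleCurveUnion Γ) (hΓΩ : Γ ⊆ Ω)
    (δ : ℝ) (hδ : 0 < δ)
    (H : ℕ → ℝ) (hHpos : ∀ n, 0 < H n)
    (hHlim : Filter.Tendsto H Filter.atTop (nhds 0))
    (S : ℕ → Set (EuclideanSpace ℝ (Fin 2)))
    (hSmeas : ∀ n, MeasurableSet (S n)) (hSsub : ∀ n, S n ⊆ Γ)
    (hSδ : ∀ n, μH[1] (S n) ≤ ENNReal.ofReal δ) :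
    μH[1] Γ - ENNReal.ofReal δ ≤
      Filter.liminf (fun n : ℕ =>
        ENNReal.ofReal (1 / (2 * H n)) *
          μH[2] {x ∈ Ω | EMetric.infEdist x (Γ \ S n) ≤ ENNReal.ofReal (H n)})
        Filter.atTop := by
  have hc := simple_compact Γ hΓ
  obtain ⟨ρ, hρ, hρΩ⟩ := hc.exists_cthickening_subset_open hΩ hΓΩ
  set F : ℕ → ℝ≥0∞ := fun n : ℕ =>
        ENNReal.ofReal (1 / (2 * H n)) *
          μH[2] {x ∈ Ω | EMetric.infEdist x (Γ \ S n) ≤ ENNReal.ofReal (H n)} with hF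
  set L := Filter.liminf F Filter.atTop with hL
  set X := μH[1] Γ - ENNReal.ofReal δ with hX
  have key : ∀ ε : NNReal, 0 < ε → X ≤ ((1 + ε : NNReal) : ℝ≥0∞) * L + ε := by
    intro ε hε
    obtain ⟨M, hΓM, hM, hMf, hT⟩ := QT.simple (1 + ε) (by simpa using hε) Γ hΓ
    obtain ⟨r, hr, hT⟩ := hT ε hε
    have hev : ∀ᶠ n in Filter.atTop, X ≤ ((1 + ε : NNReal) : ℝ≥0∞) * F n + ε := by
      filter_upwards [hHlim.eventually (gt_mem_nhds hr), hHlim.eventually (gt_mem_nhds hρ)]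
        with n hn1 hn2
      have h1 := hT (H n) (hHpos n) hn1 (Γ \ S n) (hc.measurableSet.diff (hSmeas n))
        (Set.diff_subset.trans hΓM)
      have h2 : X ≤ μH[1] (Γ \ S n) := by
        rw [hX, tsub_le_iff_right]
        calc μH[1] Γ ≤ μH[1] ((Γ \ S n) ∪ S n) := by
              apply measure_mono; rw [Set.diff_union_self]; exact Set.subset_union_left
          _ ≤ μH[1] (Γ \ S n) + μH[1] (S n) := measure_union_le _ _
          _ ≤ _ := by gcongr; exact hSδ n
      refine h2.trans (h1.trans ?_)
      have h3 : {x ∈ Ω | EMetric.infEdist x (Γ \ S n) ≤ ENNReal.ofReal (H n)} =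
          Metric.cthickening (H n) (Γ \ S n) := by
        ext x
        constructor
        · intro hx; exact hx.2
        · intro hx
          refine ⟨hρΩ ?_, hx⟩
          exact Metric.cthickening_mono hn2.le _
            (Metric.cthickening_subset_of_subset _ Set.diff_subset hx)
      simp only [hF]
      rw [h3]
      have h4 := aux_vol_le (Metric.cthickening (H n) (Γ \ S n))
        Metric.isClosed_cthickening.measurableSet
      exact add_le_add (mul_le_mul' le_rfl (mul_le_mul' le_rfl h4)) le_rfl
    have h0 : ((1 + ε : NNReal) : ℝ≥0∞) ≠ 0 := by
      rw [ENNReal.coe_ne_zero]; positivity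
    have hle : (X - ε) / ((1 + ε : NNReal) : ℝ≥0∞) ≤ L := by
      refine Filter.le_liminf_of_le (by isBoundedDefault) ?_
      filter_upwards [hev] with n hn
      rw [ENNReal.div_le_iff' h0 ENNReal.coe_ne_top, tsub_le_iff_right]
      exact hn
    rw [ENNReal.div_le_iff' h0 ENNReal.coe_ne_top, tsub_le_iff_right] at hle
    exact hle
  by_cases hLt : L = ⊤
  · rw [hLt]; exact le_top
  lift L to NNReal using hLt with l
  refine ENNReal.le_of_forall_pos_le_add fun η hη _ => ?_
  have hpos : 0 < η / (l + 1) := by positivity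
  refine (key _ hpos).trans (le_of_eq ?_)
  norm_cast
  apply NNReal.eq
  push_cast
  field_simp
  ring
end

section
/- Let b > 0 and let γ : [0,b] → ℝ² be C¹ with |γ'(t)| = 1 for all t ∈ [0,b]. For η ∈ (0,b] set μ(η) := sup{|γ'(t) − γ'(t')| : t,t' ∈ [0,b], |t − t'| ≤ η}. Then for all t,t' ∈ [0,b] with |t − t'| ≤ η one has |γ(t) − γ(t')| ≥ (1 − μ(η)²/2)·|t − t'|. -/
/-- chord-length lower bound for unit-speed `C¹` curves:
if `γ` is `C¹` with `|γ'| = 1` on `[0,b]` and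
`μ(η) = sup {|γ'(t) − γ'(t')| : t, t' ∈ [0,b], |t − t'| ≤ η}`, then
`|γ(t) − γ(t')| ≥ (1 − μ(η)²/2)·|t − t'|` whenever `|t − t'| ≤ η`. -/
theorem stmt3 (b : ℝ) (hb : 0 < b) (γ : ℝ → EuclideanSpace ℝ (Fin 2))
    (hγ : ContDiff ℝ 1 γ) (hunit : ∀ t ∈ Set.Icc 0 b, ‖deriv γ t‖ = 1)
    (η : ℝ) (hη : η ∈ Set.Ioc 0 b) :
    ∀ t ∈ Set.Icc 0 b, ∀ t' ∈ Set.Icc 0 b, |t - t'| ≤ η →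
      (1 - (sSup {d : ℝ | ∃ s ∈ Set.Icc 0 b, ∃ s' ∈ Set.Icc 0 b,
          |s - s'| ≤ η ∧ d = ‖deriv γ s - deriv γ s'‖}) ^ 2 / 2) * |t - t'|
        ≤ ‖γ t - γ t'‖ := by
  set S := {d : ℝ | ∃ s ∈ Set.Icc 0 b, ∃ s' ∈ Set.Icc 0 b,
          |s - s'| ≤ η ∧ d = ‖deriv γ s - deriv γ s'‖} with hS
  have hbdd : BddAbove S := by
    refine ⟨2, ?_⟩
    rintro d ⟨s, hs, s', hs', -, rfl⟩
    have h := norm_sub_le (deriv γ s) (deriv γ s')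
    rw [hunit s hs, hunit s' hs'] at h
    linarith
  have key : ∀ t ∈ Set.Icc 0 b, ∀ t' ∈ Set.Icc 0 b, |t - t'| ≤ η → t' < t →
      (1 - (sSup S) ^ 2 / 2) * |t - t'| ≤ ‖γ t - γ t'‖ := by
    intro t ht t' ht' htt hlt
    have hd : ∀ x, HasDerivAt (fun s => inner ℝ (deriv γ t') (γ s))
        (inner ℝ (deriv γ t') (deriv γ x)) x := by
      intro x
      have h1 : HasDerivAt γ (deriv γ x) x :=
        (hγ.differentiable (by norm_num) x).hasDerivAt
      simpa using (hasDerivAt_const x (deriv γ t')).inner ℝ h1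
    obtain ⟨c, hc, hce⟩ := exists_hasDerivAt_eq_slope
      (fun s => inner ℝ (deriv γ t') (γ s))
      (fun x => inner ℝ (deriv γ t') (deriv γ x)) hlt
      (fun x _ => (hd x).continuousAt.continuousWithinAt) (fun x _ => hd x)
    have hpos : 0 < t - t' := sub_pos.2 hlt
    rw [abs_of_pos hpos] at htt ⊢
    have hcI : c ∈ Set.Icc 0 b := ⟨ht'.1.trans hc.1.le, hc.2.le.trans ht.2⟩
    have hmem : ‖deriv γ t' - deriv γ c‖ ≤ sSup S := by
      refine le_csSup hbdd ⟨t', ht', c, hcI, ?_, rfl⟩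
      rw [abs_le]
      constructor <;> linarith [hc.1, hc.2]
    have hsq := norm_sub_sq_real (deriv γ t') (deriv γ c)
    rw [hunit t' ht', hunit c hcI] at hsq
    have hsq2 : ‖deriv γ t' - deriv γ c‖ ^ 2 ≤ (sSup S) ^ 2 :=
      pow_le_pow_left₀ (norm_nonneg _) hmem 2
    rw [eq_div_iff hpos.ne', ← inner_sub_right] at hce
    have hcs := real_inner_le_norm (deriv γ t') (γ t - γ t')
    rw [hunit t' ht', one_mul] at hcs
    refine le_trans ?_ hcs
    rw [← hce]
    exact mul_le_mul_of_nonneg_right (by linarith) hpos.le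
  intro t ht t' ht' htt
  rcases lt_trichotomy t t' with h | h | h
  · rw [abs_sub_comm] at htt ⊢
    rw [norm_sub_rev]
    exact key t' ht' t ht htt h
  · subst h
    simp
  · exact key t ht t' ht' htt h
end

section
/- Let η : ℝ² → [0,∞) be continuous with support contained in the closed unit ball and ∫_{ℝ²} η = 1. For each m ∈ ℕ let r_m : ℝ² → [0,∞) be a C¹ function with |∇r_m(x)| ≤ 1/2 for all x ∈ ℝ², and suppose sup_{x∈ℝ²} r_m(x) → 0 as m → ∞. For f ∈ L¹(ℝ²) define the variable-radius mollification (f *'_m η)(x) := ∫_{ℝ²} f(x − r_m(x)·y)·η(y) dy. Then ∫_{ℝ²} |(f *'_m η)(x) − f(x)| dx → 0 as m → ∞. -/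
open MeasureTheory Filter Topology
open scoped ENNReal NNReal

local notation "E2" => EuclideanSpace ℝ (Fin 2)

lemma aux_lip (r : E2 → ℝ) (hr : ContDiff ℝ 1 r) (hg : ∀ x, ‖fderiv ℝ r x‖ ≤ 1 / 2) (x z : E2) :
    |r x - r z| ≤ 1 / 2 * ‖x - z‖ := by
  have := Convex.norm_image_sub_le_of_norm_fderiv_le (𝕜 := ℝ) (f := r) (C := 1 / 2)
    (s := Set.univ) (x := z) (y := x)
    (fun x _ => (hr.differentiable (by norm_num)).differentiableAt) (fun x _ => hg x) convex_univ
    (Set.mem_univ _) (Set.mem_univ _)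
  simpa [Real.norm_eq_abs] using this

lemma aux_anti (r : E2 → ℝ) (hr : ContDiff ℝ 1 r) (hg : ∀ x, ‖fderiv ℝ r x‖ ≤ 1 / 2)
    (y : E2) (hy : ‖y‖ ≤ 1) : AntilipschitzWith 2 (fun x => x - r x • y) := by
  apply AntilipschitzWith.of_le_mul_dist
  intro x z
  have h1 := aux_lip r hr hg x z
  have h2 : x - z = ((x - r x • y) - (z - r z • y)) + (r x - r z) • y := by
    rw [sub_smul]; abel
  have h3 : ‖x - z‖ ≤ ‖(x - r x • y) - (z - r z • y)‖ + |r x - r z| * ‖y‖ := by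
    conv_lhs => rw [h2]
    refine (norm_add_le _ _).trans ?_
    rw [norm_smul, Real.norm_eq_abs]
  have h4 : |r x - r z| * ‖y‖ ≤ |r x - r z| * 1 :=
    mul_le_mul_of_nonneg_left hy (abs_nonneg _)
  rw [dist_eq_norm, dist_eq_norm]
  simp only [NNReal.coe_ofNat]
  linarith

lemma aux_vol (T : E2 → E2) (hT : AntilipschitzWith 2 T) (s : Set E2) :
    volume (T ⁻¹' s) ≤ 4 * volume s := by
  have hH : Measure.IsAddHaarMeasure (Measure.hausdorffMeasure (X := E2) 2) := by
    have := isAddHaarMeasure_hausdorffMeasure (E := E2)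
    simpa using this
  have h := Measure.isAddLeftInvariant_eq_smul (volume : Measure E2)
    (Measure.hausdorffMeasure (X := E2) 2)
  rw [h]
  have h1 := hT.hausdorffMeasure_preimage_le (d := 2) (by norm_num) s
  have h2 : (((2 : ℝ≥0) : ℝ≥0∞)) ^ (2 : ℝ) = 4 := by
    rw [show (2 : ℝ) = ((2 : ℕ) : ℝ) by norm_num, ENNReal.rpow_natCast]
    norm_num
  rw [h2] at h1
  simp only [Measure.smul_apply, ENNReal.smul_def, smul_eq_mul]
  rw [mul_left_comm]
  gcongr

lemma aux_map (ν : Measure E2) [IsProbabilityMeasure ν] (hν : ∀ᵐ y ∂ν, ‖y‖ ≤ 1)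
    (r : E2 → ℝ) (hr : ContDiff ℝ 1 r) (hg : ∀ x, ‖fderiv ℝ r x‖ ≤ 1 / 2) :
    Measure.map (fun p : E2 × E2 => p.1 - r p.1 • p.2) ((volume : Measure E2).prod ν)
      ≤ (4 : ℝ≥0∞) • (volume : Measure E2) := by
  have hc : Continuous (fun p : E2 × E2 => p.1 - r p.1 • p.2) := by
    have := hr.continuous
    fun_prop
  refine Measure.le_iff.2 fun s hs => ?_
  rw [Measure.map_apply hc.measurable hs, Measure.prod_apply_symm (hc.measurable hs)]
  calc _ ≤ ∫⁻ y, 4 * volume s ∂ν := by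
        apply lintegral_mono_ae
        filter_upwards [hν] with y hy
        exact aux_vol _ (aux_anti r hr hg y hy) s
    _ = _ := by simp

lemma aux_cpt (ν : Measure E2) [IsProbabilityMeasure ν] (hν : ∀ᵐ y ∂ν, ‖y‖ ≤ 1)
    (r : ℕ → E2 → ℝ) (hr : ∀ m, Continuous (r m)) (h0 : ∀ m x, 0 ≤ r m x)
    (ε : ℕ → ℝ) (hε : ∀ m x, r m x ≤ ε m) (hε0 : Tendsto ε atTop (𝓝 0))
    (g : E2 → ℝ) (hgc : Continuous g) (hgs : HasCompactSupport g) :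
    Tendsto (fun m => ∫⁻ p : E2 × E2, ‖g (p.1 - r m p.1 • p.2) - g p.1‖ₑ
      ∂((volume : Measure E2).prod ν)) atTop (𝓝 0) := by
  obtain ⟨C, hC⟩ := hgs.exists_bound_of_continuous hgc
  set K := Metric.cthickening 1 (tsupport g) with hK
  have hKc : IsCompact K := hgs.isCompact.cthickening
  have hν' : ∀ᵐ p ∂((volume : Measure E2).prod ν), ‖p.2‖ ≤ 1 :=
    Measure.quasiMeasurePreserving_snd.ae hν
  have hr0 : ∀ x, Tendsto (fun m => r m x) atTop (𝓝 0) := fun x =>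
    squeeze_zero (fun m => h0 m x) (fun m => hε m x) hε0
  have key := tendsto_lintegral_filter_of_dominated_convergence
    (μ := (volume : Measure E2).prod ν) (l := atTop)
    (F := fun m (p : E2 × E2) => ‖g (p.1 - r m p.1 • p.2) - g p.1‖ₑ) (f := fun _ => 0)
    (fun p => (K ×ˢ (Set.univ : Set E2)).indicator (fun _ => ENNReal.ofReal (2 * C)) p)
    ?_ ?_ ?_ ?_
  · simpa using key
  · refine Eventually.of_forall fun m => ?_
    have := hr m
    have : Continuous (fun p : E2 × E2 => g (p.1 - r m p.1 • p.2) - g p.1) := by fun_prop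
    exact this.measurable.enorm
  · filter_upwards [hε0.eventually (gt_mem_nhds (zero_lt_one))] with m hm
    filter_upwards [hν'] with p hp
    by_cases hpK : p.1 ∈ K
    · rw [Set.indicator_of_mem (by simpa using hpK), ← ofReal_norm]
      apply ENNReal.ofReal_le_ofReal
      refine (norm_sub_le _ _).trans ?_
      linarith [hC (p.1 - r m p.1 • p.2), hC p.1]
    · have h1 : g p.1 = 0 := image_eq_zero_of_notMem_tsupport fun h =>
        hpK (Metric.self_subset_cthickening _ h)
      have h2 : g (p.1 - r m p.1 • p.2) = 0 := image_eq_zero_of_notMem_tsupport fun h => by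
        refine hpK (Metric.mem_cthickening_of_dist_le _ _ _ _ h ?_)
        rw [dist_eq_norm, sub_sub_cancel, norm_smul, Real.norm_eq_abs, abs_of_nonneg (h0 m _)]
        have := hε m p.1
        have := h0 m p.1
        nlinarith [norm_nonneg p.2]
      simp [h1, h2]
  · rw [lintegral_indicator (hKc.measurableSet.prod MeasurableSet.univ)]
    simp only [lintegral_const, Measure.restrict_apply_univ, Measure.prod_prod, measure_univ,
      mul_one]
    exact ENNReal.mul_ne_top ENNReal.ofReal_ne_top hKc.measure_lt_top.ne
  · refine Eventually.of_forall fun p => ?_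
    have h1 : Tendsto (fun m => p.1 - r m p.1 • p.2) atTop (𝓝 p.1) := by
      have := ((hr0 p.1).smul_const p.2).const_sub p.1
      simpa using this
    have h2 : Tendsto (fun m => g (p.1 - r m p.1 • p.2) - g p.1) atTop (𝓝 0) := by
      have := ((hgc.tendsto p.1).comp h1).sub_const (g p.1)
      simpa using this
    simpa using h2.enorm

lemma aux_main (ν : Measure E2) [IsProbabilityMeasure ν] (hν : ∀ᵐ y ∂ν, ‖y‖ ≤ 1)
    (r : ℕ → E2 → ℝ) (hr : ∀ m, ContDiff ℝ 1 (r m)) (h0 : ∀ m x, 0 ≤ r m x)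
    (hg : ∀ m x, ‖fderiv ℝ (r m) x‖ ≤ 1 / 2)
    (ε : ℕ → ℝ) (hε : ∀ m x, r m x ≤ ε m) (hε0 : Tendsto ε atTop (𝓝 0))
    (f : E2 → ℝ) (hf : Integrable f) :
    Tendsto (fun m => ∫⁻ p : E2 × E2, ‖f (p.1 - r m p.1 • p.2) - f p.1‖ₑ
      ∂((volume : Measure E2).prod ν)) atTop (𝓝 0) := by
  rw [ENNReal.tendsto_nhds_zero]
  intro e he
  have he6 : e / 6 ≠ 0 := by simp [he.ne']
  obtain ⟨g, hgs, hfg, hgc, hgi⟩ := hf.exists_hasCompactSupport_lintegral_sub_le he6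
  have hcpt := aux_cpt ν hν r (fun m => (hr m).continuous) h0 ε hε hε0 g hgc hgs
  rw [ENNReal.tendsto_nhds_zero] at hcpt
  filter_upwards [hcpt (e / 6) (pos_iff_ne_zero.2 he6)] with m hm
  set Φ : E2 × E2 → E2 := fun p => p.1 - r m p.1 • p.2 with hΦ
  have hc : Continuous Φ := by
    have := (hr m).continuous
    fun_prop
  have hmap := aux_map ν hν (r m) (hr m) (hg m)
  have hd : AEMeasurable (fun x => ‖f x - g x‖ₑ) (volume : Measure E2) :=
    (hf.sub hgi).aestronglyMeasurable.enorm
  have hd4 : AEMeasurable (fun x => ‖f x - g x‖ₑ)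
      (Measure.map Φ ((volume : Measure E2).prod ν)) :=
    (hd.smul_measure 4).mono_measure hmap
  have hA : ∫⁻ p, ‖f (Φ p) - g (Φ p)‖ₑ ∂((volume : Measure E2).prod ν) ≤ 4 * (e / 6) := by
    rw [← lintegral_map' (f := fun x => ‖f x - g x‖ₑ) hd4 hc.aemeasurable]
    refine (lintegral_mono' hmap le_rfl).trans ?_
    rw [lintegral_smul_measure, smul_eq_mul]
    gcongr
  have hd1 : AEMeasurable (fun p : E2 × E2 => ‖f p.1 - g p.1‖ₑ)
      ((volume : Measure E2).prod ν) :=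
    hd.comp_quasiMeasurePreserving Measure.quasiMeasurePreserving_fst
  have hB : ∫⁻ p : E2 × E2, ‖f p.1 - g p.1‖ₑ ∂((volume : Measure E2).prod ν) ≤ e / 6 := by
    rw [lintegral_prod _ hd1]
    simpa using hfg
  have hm1 : AEMeasurable (fun p => ‖f (Φ p) - g (Φ p)‖ₑ) ((volume : Measure E2).prod ν) :=
    hd4.comp_aemeasurable hc.aemeasurable
  calc ∫⁻ p : E2 × E2, ‖f (Φ p) - f p.1‖ₑ ∂((volume : Measure E2).prod ν)
      ≤ ∫⁻ p : E2 × E2, (‖f (Φ p) - g (Φ p)‖ₑ + (‖f p.1 - g p.1‖ₑ + ‖g (Φ p) - g p.1‖ₑ))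
          ∂((volume : Measure E2).prod ν) := by
        refine lintegral_mono fun p => ?_
        have : f (Φ p) - f p.1 =
          (f (Φ p) - g (Φ p)) + (-(f p.1 - g p.1) + (g (Φ p) - g p.1)) := by ring
        simp only
        rw [this]
        refine (enorm_add_le _ _).trans ?_
        gcongr
        refine (enorm_add_le _ _).trans ?_
        rw [enorm_neg]
    _ ≤ 4 * (e / 6) + (e / 6 + e / 6) := by
        rw [lintegral_add_left' hm1, lintegral_add_left' hd1]
        gcongr
    _ = 6 * (e / 6) := by ring
    _ = e := ENNReal.mul_div_cancel (by norm_num) (by norm_num)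
    _ ≤ e := le_rfl

/-- `L¹` convergence of the variable-radius mollifier: if `η ≥ 0` is a
continuous kernel supported in the closed unit ball with `∫ η = 1`, and `r_m` are `C¹`
nonnegative radius functions with `|∇r_m| ≤ 1/2` and `sup r_m → 0`, then for every
`f ∈ L¹(ℝ²)` the nonhomogeneous mollifications `(f *'_m η)(x) = ∫ f(x − r_m(x)y) η(y) dy`
converge to `f` in `L¹`. -/
theorem stmt8 (η : EuclideanSpace ℝ (Fin 2) → ℝ) (hηcont : Continuous η)
    (hηnonneg : ∀ y, 0 ≤ η y)
    (hηsupp : Function.support η ⊆ Metric.closedBall (0 : EuclideanSpace ℝ (Fin 2)) 1)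
    (hηint : ∫ y, η y = 1)
    (r : ℕ → EuclideanSpace ℝ (Fin 2) → ℝ)
    (hrC1 : ∀ m, ContDiff ℝ 1 (r m)) (hrnonneg : ∀ m x, 0 ≤ r m x)
    (hrgrad : ∀ m x, ‖fderiv ℝ (r m) x‖ ≤ 1 / 2)
    (hrsup : ∃ ε : ℕ → ℝ, (∀ m x, r m x ≤ ε m) ∧
      Filter.Tendsto ε Filter.atTop (nhds 0))
    (f : EuclideanSpace ℝ (Fin 2) → ℝ) (hf : Integrable f) :
    Filter.Tendsto
      (fun m : ℕ => ∫ x, |(∫ y, f (x - r m x • y) * η y) - f x|)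
      Filter.atTop (nhds 0) := by
  obtain ⟨ε, hε, hε0⟩ := hrsup
  have hηi : Integrable η := by
    by_contra h
    rw [integral_undef h] at hηint
    norm_num at hηint
  have hηm : Measurable (fun y => ENNReal.ofReal (η y)) := hηcont.measurable.ennreal_ofReal
  set ν : Measure (EuclideanSpace ℝ (Fin 2)) :=
    volume.withDensity (fun y => ENNReal.ofReal (η y)) with hνdef
  have hνp : IsProbabilityMeasure ν := by
    constructor
    rw [hνdef, withDensity_apply _ MeasurableSet.univ, Measure.restrict_univ,
      ← ofReal_integral_eq_lintegral_ofReal hηi (Filter.Eventually.of_forall hηnonneg), hηint]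
    simp
  have hν : ∀ᵐ y ∂ν, ‖y‖ ≤ 1 := by
    rw [hνdef, ae_withDensity_iff hηm]
    refine Filter.Eventually.of_forall fun y hy => ?_
    have : y ∈ Function.support η := by
      intro h
      exact hy (by simp [h])
    simpa using hηsupp this
  have hint : ∀ h : EuclideanSpace ℝ (Fin 2) → ℝ, ∫ y, h y * η y = ∫ y, h y ∂ν := by
    intro h
    rw [hνdef, integral_withDensity_eq_integral_toReal_smul hηm
      (Filter.Eventually.of_forall fun _ => ENNReal.ofReal_lt_top)]
    refine integral_congr_ae (Filter.Eventually.of_forall fun y => ?_)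
    simp only [ENNReal.toReal_ofReal (hηnonneg y), smul_eq_mul]
    ring
  have hmain := aux_main ν hν r hrC1 hrnonneg hrgrad ε hε hε0 f hf
  rw [tendsto_zero_iff_enorm_tendsto_zero]
  refine tendsto_of_tendsto_of_tendsto_of_le_of_le tendsto_const_nhds hmain
    (fun _ => zero_le) (fun m => ?_)
  refine (enorm_integral_le_lintegral_enorm _).trans ?_
  have hc : Continuous (fun p : EuclideanSpace ℝ (Fin 2) × EuclideanSpace ℝ (Fin 2) =>
      p.1 - r m p.1 • p.2) := by
    have := (hrC1 m).continuous
    fun_prop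
  have hi1 : Integrable (fun p : EuclideanSpace ℝ (Fin 2) × EuclideanSpace ℝ (Fin 2) =>
      f (p.1 - r m p.1 • p.2)) ((volume : Measure (EuclideanSpace ℝ (Fin 2))).prod ν) :=
    ((hf.smul_measure (c := 4) (by norm_num)).mono_measure
      (aux_map ν hν (r m) (hrC1 m) (hrgrad m))).comp_measurable hc.measurable
  have hi2 : Integrable (fun p : EuclideanSpace ℝ (Fin 2) × EuclideanSpace ℝ (Fin 2) =>
      f p.1) ((volume : Measure (EuclideanSpace ℝ (Fin 2))).prod ν) := hf.comp_fst ν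
  have hme : AEMeasurable (fun p : EuclideanSpace ℝ (Fin 2) × EuclideanSpace ℝ (Fin 2) =>
      ‖f (p.1 - r m p.1 • p.2) - f p.1‖ₑ)
      ((volume : Measure (EuclideanSpace ℝ (Fin 2))).prod ν) :=
    (hi1.sub hi2).aestronglyMeasurable.enorm
  rw [lintegral_prod _ hme]
  refine lintegral_mono_ae ?_
  filter_upwards [hi1.prod_right_ae] with x hx
  rw [hint (fun y => f (x - r m x • y))]
  have : (∫ y, f (x - r m x • y) ∂ν) - f x = ∫ y, (f (x - r m x • y) - f x) ∂ν := by
    rw [integral_sub hx (integrable_const _)]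
    simp
  rw [this, Real.enorm_abs]
  exact enorm_integral_le_lintegral_enorm _
end
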